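/- Let X and U be normed spaces, V : X → [0,∞), g : X × U → X, α positive definite, γ ∈ K∞, and suppose V(g(x,ξ)) ≤ max{α(V(x)), γ(‖ξ‖)} for all x ∈ X, ξ ∈ U. Let ρ ∈ K∞ satisfy α(r) < ρ(r) for all r > 0, and define χ(r) := max{γ(r), ρ⁻¹(γ(r))} for r ≥ 0. Then χ ∈ K∞, χ ≥ γ pointwise, and for all x ∈ X and ξ ∈ U with V(x) ≥ χ(‖ξ‖) one has V(g(x,ξ)) ≤ ρ(V(x)). -/

import Mathlib

open Set Filter Topology

/-- A class `K` function. -/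
def ClassK (γ : ℝ → ℝ) : Prop :=
  ContinuousOn γ (Set.Ici 0) ∧ StrictMonoOn γ (Set.Ici 0) ∧ γ 0 = 0

/-- A class `K∞` function. -/
def ClassKinf (γ : ℝ → ℝ) : Prop :=
  ClassK γ ∧ Filter.Tendsto γ Filter.atTop Filter.atTop

/-- A positive definite function. -/
def PosDef (φ : ℝ → ℝ) : Prop :=
  ContinuousOn φ (Set.Ici 0) ∧ φ 0 = 0 ∧ ∀ s > (0:ℝ), 0 < φ s

/-- Class `K` functions are nonnegative on `[0,∞)`. -/
theorem ClassK.nonneg {γ : ℝ → ℝ} (hγ : ClassK γ) {r : ℝ} (hr : 0 ≤ r) : 0 ≤ γ r :=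
  hγ.2.2 ▸ hγ.2.1.monotoneOn Set.self_mem_Ici hr hr

/-- A right inverse of a class `K` function on `[0,∞)` is strictly increasing. -/
theorem ClassK.strictMonoOn_inverse {ρ ρinv : ℝ → ℝ} (hρ : ClassK ρ)
    (hright : ∀ s ≥ (0 : ℝ), ρ (ρinv s) = s) (hnonneg : ∀ s ≥ (0 : ℝ), 0 ≤ ρinv s) :
    StrictMonoOn ρinv (Set.Ici 0) := by
  intro a ha b hb hab
  rw [← hρ.2.1.lt_iff_lt (hnonneg a ha) (hnonneg b hb), hright a ha, hright b hb]
  exact hab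

/-- The inverse of a class `K∞` function is of class `K∞`. -/
theorem ClassKinf.inverse {ρ ρinv : ℝ → ℝ} (hρ : ClassKinf ρ)
    (hleft : ∀ r ≥ (0 : ℝ), ρinv (ρ r) = r) (hright : ∀ s ≥ (0 : ℝ), ρ (ρinv s) = s)
    (hnonneg : ∀ s ≥ (0 : ℝ), 0 ≤ ρinv s) : ClassKinf ρinv := by
  have hinv := hρ.1.strictMonoOn_inverse hright hnonneg
  have hρnonneg : ∀ r ≥ (0 : ℝ), 0 ≤ ρ r := fun _ hr => hρ.1.nonneg hr
  refine ⟨⟨?_, hinv, by simpa [hρ.1.2.2] using hleft 0 le_rfl⟩, ?_⟩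
  · -- Extend `ρinv` by the identity to a monotone surjection of the real line.
    let f : ℝ → ℝ := fun s => if s < 0 then s else ρinv s
    have hf : Monotone f := by
      intro a b hab
      by_cases ha : a < 0 <;> by_cases hb : b < 0 <;> simp only [f, ha, hb, if_true, if_false]
      · exact hab
      · exact ha.le.trans (hnonneg b (not_lt.mp hb))
      · exact absurd (hab.trans_lt hb) ha
      · exact hinv.monotoneOn (not_lt.mp ha) (not_lt.mp hb) hab
    have hsurj : Function.Surjective f := by
      intro r
      by_cases hr : r < 0
      · exact ⟨r, if_pos hr⟩
      · have hr' := not_lt.mp hr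
        exact ⟨ρ r, (if_neg (hρnonneg r hr').not_gt).trans (hleft r hr')⟩
    exact (hf.continuous_of_surjective hsurj).continuousOn.congr
      fun s hs => (if_neg (not_lt.mpr hs)).symm
  · refine tendsto_atTop.mpr fun b => ?_
    have hb : (0 : ℝ) ≤ max b 0 := le_max_right b 0
    filter_upwards [eventually_ge_atTop (ρ (max b 0))] with s hs
    have h := hinv.monotoneOn (hρnonneg _ hb) ((hρnonneg _ hb).trans hs) hs
    rw [hleft _ hb] at h
    exact (le_max_left b 0).trans h

/-- Class `K∞` is closed under composition. -/
theorem ClassKinf.comp {γ δ : ℝ → ℝ} (hδ : ClassKinf δ) (hγ : ClassKinf γ) :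
    ClassKinf fun r => δ (γ r) := by
  have hmaps : Set.MapsTo γ (Set.Ici 0) (Set.Ici 0) := fun _ hr => hγ.1.nonneg hr
  exact ⟨⟨hδ.1.1.comp hγ.1.1 hmaps, hδ.1.2.1.comp hγ.1.2.1 hmaps,
    by simp only [hγ.1.2.2, hδ.1.2.2]⟩, hδ.2.comp hγ.2⟩

/-- Class `K∞` is closed under pointwise maxima. -/
theorem ClassKinf.sup {γ δ : ℝ → ℝ} (hγ : ClassKinf γ) (hδ : ClassKinf δ) :
    ClassKinf fun r => max (γ r) (δ r) :=
  ⟨⟨ContinuousOn.sup hγ.1.1 hδ.1.1,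
    fun _ ha _ hb hab => max_lt_max (hγ.1.2.1 ha hb hab) (hδ.1.2.1 ha hb hab),
    by simp only [hγ.1.2.2, hδ.1.2.2, max_self]⟩,
    tendsto_atTop_mono (fun r => le_max_left (γ r) (δ r)) hγ.2⟩

/-- the dissipative-form jump estimate
`V(g(x,ξ)) ≤ max{α(V(x)), γ(‖ξ‖)}` implies the implication-form jump estimate
`V(x) ≥ χ(‖ξ‖) → V(g(x,ξ)) ≤ ρ(V(x))` with `χ = max{γ, ρ⁻¹∘γ}`.
Here `ρinv` is the inverse of `ρ ∈ K∞` on `[0,∞)`. -/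
theorem stmt_11 {X U : Type*} [NormedAddCommGroup X] [NormedAddCommGroup U]
    (V : X → ℝ) (hVnn : ∀ x, 0 ≤ V x)
    (g : X × U → X) (α γ ρ ρinv : ℝ → ℝ)
    (hα : PosDef α) (hγ : ClassKinf γ) (hρ : ClassKinf ρ)
    (hαρ : ∀ r > (0:ℝ), α r < ρ r)
    (hρinv1 : ∀ r ≥ (0:ℝ), ρinv (ρ r) = r)
    (hρinv2 : ∀ s ≥ (0:ℝ), ρ (ρinv s) = s)
    (hρinv3 : ∀ s ≥ (0:ℝ), 0 ≤ ρinv s)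
    (hjump : ∀ (x : X) (ξ : U), V (g (x, ξ)) ≤ max (α (V x)) (γ ‖ξ‖)) :
    ClassKinf (fun r => max (γ r) (ρinv (γ r))) ∧
    (∀ r ≥ (0:ℝ), γ r ≤ max (γ r) (ρinv (γ r))) ∧
    ∀ (x : X) (ξ : U), max (γ ‖ξ‖) (ρinv (γ ‖ξ‖)) ≤ V x →
      V (g (x, ξ)) ≤ ρ (V x) := by
  refine ⟨hγ.sup ((hρ.inverse hρinv1 hρinv2 hρinv3).comp hγ), fun _ _ => le_max_left _ _,
    fun x ξ hx => (hjump x ξ).trans (max_le ?_ ?_)⟩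
  · rcases (hVnn x).eq_or_lt with h | h
    · rw [← h, hα.2.1, hρ.1.2.2]
    · exact (hαρ _ h).le
  · have hγξ : 0 ≤ γ ‖ξ‖ := hγ.1.nonneg (norm_nonneg ξ)
    calc γ ‖ξ‖ = ρ (ρinv (γ ‖ξ‖)) := (hρinv2 _ hγξ).symm
      _ ≤ ρ (V x) := hρ.1.2.1.monotoneOn (hρinv3 _ hγξ) (hVnn x) ((le_max_right _ _).trans hx)
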